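/- Let {x_k} be a sequence in ℝⁿ converging to x*. If β(x_k) → 0 and φ(x_k) → 0 as k → ∞, then x* is a global minimizer of F. -/

import Mathlib

open Filter Finset

/-- sign function: 1 if positive, -1 if negative, 0 if zero. -/
noncomputable def sgn (t : ℝ) : ℝ := if 0 < t then 1 else if t < 0 then -1 else 0

/-- the component of the optimality measure `β` for the zero variables,
given the regularization weight `lam`, the gradient component `gi` and the
variable component `xi`. -/
noncomputable def betaC (lam gi xi : ℝ) : ℝ :=
  if xi = 0 ∧ gi + lam < 0 then gi + lam
  else if xi = 0 ∧ 0 < gi - lam then gi - lam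
  else 0

/-- the component of the optimality measure `φ` for the nonzero variables. -/
noncomputable def phiC (lam gi xi : ℝ) : ℝ :=
  if xi = 0 then 0
  else if 0 < xi ∧ 0 < gi + lam then min (gi + lam) (max xi (gi - lam))
  else if xi < 0 ∧ gi - lam < 0 then max (gi - lam) (min xi (gi + lam))
  else gi + lam * sgn xi

/-- First-order lower bound for a convex function with a gradient at `x`. -/
theorem ConvexOn.add_inner_gradient_le {E : Type*} [NormedAddCommGroup E]
    [InnerProductSpace ℝ E] [CompleteSpace E] {f : E → ℝ} {g x : E}
    (hf : ConvexOn ℝ Set.univ f) (hg : HasGradientAt f g x) (z : E) :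
    f x + inner ℝ g (z - x) ≤ f z := by
  have hc : ConvexOn ℝ Set.univ (f ∘ AffineMap.lineMap (k := ℝ) x z) := by
    simpa using hf.comp_affineMap (AffineMap.lineMap (k := ℝ) x z)
  have hd : HasDerivAt (f ∘ AffineMap.lineMap (k := ℝ) x z) (inner ℝ g (z - x)) 0 := by
    have hfd := hg.hasFDerivAt
    rw [← AffineMap.lineMap_apply_zero (k := ℝ) x z] at hfd
    simpa using hfd.comp_hasDerivAt (0 : ℝ) AffineMap.hasDerivAt_lineMap
  have h := hc.le_slope_of_hasDerivAt (Set.mem_univ 0) (Set.mem_univ 1) zero_lt_one hd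
  simp [slope_def_field] at h
  linarith

theorem abs_le_add_abs_betaC_add_abs_phiC {lam : ℝ} (hlam : 0 < lam) (g x : ℝ) :
    |g| ≤ lam + |betaC lam g x| + |phiC lam g x| := by
  simp only [betaC, phiC, sgn, mul_ite, mul_one, mul_neg, mul_zero]
  grind

theorem min_abs_le_abs_phiC_of_pos (lam g : ℝ) {x : ℝ} (hx : 0 < x) :
    min |g + lam| x ≤ |phiC lam g x| := by
  simp only [phiC, sgn, mul_ite, mul_one, mul_neg, mul_zero]
  grind

theorem min_abs_le_abs_phiC_of_neg (lam g : ℝ) {x : ℝ} (hx : x < 0) :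
    min |g - lam| (-x) ≤ |phiC lam g x| := by
  simp only [phiC, sgn, mul_ite, mul_one, mul_neg, mul_zero]
  grind

/-- The limiting values of the gradient component `g` and the variable `x` satisfy the
componentwise optimality conditions when the measures `β` and `φ` tend to zero. -/
theorem optimality_of_tendsto_betaC_phiC {ι : Type*} {l : Filter ι} [l.NeBot] {lam : ℝ}
    (hlam : 0 < lam) {g x : ι → ℝ} {gs xs : ℝ}
    (hg : Tendsto g l (nhds gs)) (hx : Tendsto x l (nhds xs))
    (hbeta : Tendsto (fun k => betaC lam (g k) (x k)) l (nhds 0))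
    (hphi : Tendsto (fun k => phiC lam (g k) (x k)) l (nhds 0)) :
    |gs| ≤ lam ∧ (0 < xs → gs = -lam) ∧ (xs < 0 → gs = lam) := by
  refine ⟨?_, fun hpos => ?_, fun hneg => ?_⟩
  · have h := le_of_tendsto_of_tendsto' hg.abs ((hbeta.abs.const_add lam).add hphi.abs)
      fun k => abs_le_add_abs_betaC_add_abs_phiC hlam (g k) (x k)
    simpa using h
  · have h := le_of_tendsto_of_tendsto ((hg.add_const lam).abs.min hx) hphi.abs
      ((hx.eventually_const_lt hpos).mono fun k hk => min_abs_le_abs_phiC_of_pos lam (g k) hk)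
    grind
  · have h := le_of_tendsto_of_tendsto ((hg.sub_const lam).abs.min hx.neg) hphi.abs
      ((hx.eventually_lt_const hneg).mono fun k hk => min_abs_le_abs_phiC_of_neg lam (g k) hk)
    grind

theorem mul_abs_sub_le_of_optimality {lam g x : ℝ} (hg : |g| ≤ lam)
    (hpos : 0 < x → g = -lam) (hneg : x < 0 → g = lam) (z : ℝ) :
    lam * |x| ≤ g * (z - x) + lam * |z| := by
  have hz : -(g * z) ≤ lam * |z| :=
    calc -(g * z) ≤ |g * z| := neg_le_abs _
      _ = |g| * |z| := abs_mul g z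
      _ ≤ lam * |z| := by gcongr
  have hx : lam * |x| = -(g * x) := by
    rcases lt_trichotomy x 0 with h | rfl | h
    · rw [abs_of_neg h, hneg h]; ring
    · simp
    · rw [abs_of_pos h, hpos h]; ring
  linarith

/-- if `x_k → x*`, `β(x_k) → 0` and `φ(x_k) → 0`, then `x*` is a global
minimizer of `F = f + λ‖·‖₁`. -/
theorem stmt2 (n : ℕ) (hn : 1 ≤ n)
    (f : EuclideanSpace ℝ (Fin n) → ℝ)
    (hconv : ConvexOn ℝ Set.univ f) (hdiff : ContDiff ℝ 1 f)
    (lam : ℝ) (hlam : 0 < lam)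
    (F : EuclideanSpace ℝ (Fin n) → ℝ)
    (hF : ∀ x, F x = f x + lam * ∑ i, |x i|)
    (x : ℕ → EuclideanSpace ℝ (Fin n)) (xs : EuclideanSpace ℝ (Fin n))
    (hx : Tendsto x atTop (nhds xs))
    (hbeta : ∀ i : Fin n,
      Tendsto (fun k => betaC lam (gradient f (x k) i) (x k i)) atTop (nhds 0))
    (hphi : ∀ i : Fin n,
      Tendsto (fun k => phiC lam (gradient f (x k) i) (x k i)) atTop (nhds 0)) :
    ∀ z, F xs ≤ F z := by
  intro z
  have hgrad : Continuous (gradient f) :=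
    (InnerProductSpace.toDual ℝ (EuclideanSpace ℝ (Fin n))).symm.continuous.comp
      (hdiff.continuous_fderiv one_ne_zero)
  have hcoord (i : Fin n) : lam * |xs i| ≤ gradient f xs i * (z i - xs i) + lam * |z i| := by
    have hcont : Continuous fun y : EuclideanSpace ℝ (Fin n) => y i := by fun_prop
    obtain ⟨h₁, h₂, h₃⟩ := optimality_of_tendsto_betaC_phiC hlam
      (((hcont.comp hgrad).tendsto xs).comp hx) ((hcont.tendsto xs).comp hx) (hbeta i) (hphi i)
    exact mul_abs_sub_le_of_optimality h₁ h₂ h₃ (z i)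
  have hfirst := hconv.add_inner_gradient_le
    ((hdiff.differentiable one_ne_zero) xs).hasGradientAt z
  have hinner : inner ℝ (gradient f xs) (z - xs) = ∑ i, gradient f xs i * (z i - xs i) := by
    simp only [PiLp.inner_apply, PiLp.sub_apply, RCLike.inner_apply, conj_trivial, mul_comm]
  have hsum := Finset.sum_le_sum fun i (_ : i ∈ Finset.univ) => hcoord i
  rw [Finset.sum_add_distrib, ← Finset.mul_sum, ← Finset.mul_sum] at hsum
  rw [hF, hF]
  linarith
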